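/- Let Ĝ be a swap-maximal loopy graph. If there exists a vertex u ∈ V^0 with degree at least 2, then V^1 is a clique: any two distinct vertices of V^1 are adjacent in Ĝ. -/

import Mathlib

open scoped Classical

/-- A loopy graph: at most one edge between any two distinct vertices and at most one
self-loop at each vertex, encoded as a symmetric adjacency relation. -/
structure LoopyGraph (V : Type) where
  Adj : V → V → Prop
  symm : ∀ u v : V, Adj u v → Adj v u

namespace LoopyGraph

variable {V : Type}

/-- The neighbors of `u` (vertices other than `u` adjacent to `u`). -/
def nbr (G : LoopyGraph V) (u : V) : Set V := {v | v ≠ u ∧ G.Adj u v}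

/-- Degree of a vertex: each self-loop contributes `2`. -/
noncomputable def deg (G : LoopyGraph V) (u : V) : ℕ :=
  (G.nbr u).ncard + (if G.Adj u u then 2 else 0)

/-- `G₂` is obtained from `G₁` by a single valid double edge swap
`(u,v),(x,y) ⤳ (u,x),(v,y)`: the two removed edges are distinct edges of `G₁`, the two
added edges are distinct and not already present (no multiedge and no doubled
self-loop is created). -/
def DoubleEdgeSwap (G₁ G₂ : LoopyGraph V) : Prop :=
  ∃ u v x y : V,
    G₁.Adj u v ∧ G₁.Adj x y ∧
    s(u, v) ≠ s(x, y) ∧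
    ¬ G₁.Adj u x ∧ ¬ G₁.Adj v y ∧ s(u, x) ≠ s(v, y) ∧
    ∀ a b : V, G₂.Adj a b ↔
      ((G₁.Adj a b ∧ s(a, b) ≠ s(u, v) ∧ s(a, b) ≠ s(x, y)) ∨
        s(a, b) = s(u, x) ∨ s(a, b) = s(v, y))

/-- `G₂` is reachable from `G₁` by a finite sequence of valid double edge swaps. -/
def Reach (G₁ G₂ : LoopyGraph V) : Prop :=
  Relation.ReflTransGen DoubleEdgeSwap G₁ G₂

/-- Vertices at (shortest-path) distance at most `k` from the set of loop-free vertices. -/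
def within (G : LoopyGraph V) : ℕ → Set V
  | 0 => {v | ¬ G.Adj v v}
  | (k + 1) => within G k ∪ {v | ∃ u ∈ within G k, G.Adj v u}

/-- `Vset G 0 = V^0` is the set of vertices with no self-loop; for `k ≥ 1`,
`Vset G k = V^k` is the set of vertices (necessarily carrying a self-loop) whose
shortest-path distance to `V^0` is exactly `k`. -/
def Vset (G : LoopyGraph V) : ℕ → Set V
  | 0 => {v | ¬ G.Adj v v}
  | (k + 1) => within G (k + 1) \ within G k

/-- `V^∞`: vertices (with a self-loop) having no path to `V^0`. -/
def Vinf (G : LoopyGraph V) : Set V := {v | ∀ k : ℕ, v ∉ within G k}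

/-- A set of vertices is a clique when all pairs of distinct members are adjacent. -/
def IsClique (G : LoopyGraph V) (s : Set V) : Prop :=
  ∀ x ∈ s, ∀ y ∈ s, x ≠ y → G.Adj x y

/-- The set of vertices carrying a self-loop. -/
def selfLoops (G : LoopyGraph V) : Set V := {v | G.Adj v v}

/-- The edges of `G` with both endpoints in `V^0`. -/
def V0edges (G : LoopyGraph V) : Set (Sym2 V) :=
  {e | ∃ u v : V, e = s(u, v) ∧ G.Adj u v ∧ u ∈ Vset G 0 ∧ v ∈ Vset G 0}

/-- `Ĝ` is swap-maximal: among all loopy graphs reachable from it by double edge swaps it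
has the maximum number of self-loops, and subject to that the maximum number of edges with
both endpoints in `V^0`. -/
def SwapMaximal (G : LoopyGraph V) : Prop :=
  ∀ H : LoopyGraph V, Reach G H →
    (selfLoops H).ncard ≤ (selfLoops G).ncard ∧
      ((selfLoops H).ncard = (selfLoops G).ncard →
        (V0edges H).ncard ≤ (V0edges G).ncard)

/-- `K` is a largest clique contained in `V^0`, and it has exactly `d` vertices. -/
def LargestV0Clique (G : LoopyGraph V) (K : Set V) (d : ℕ) : Prop :=
  K ⊆ Vset G 0 ∧ IsClique G K ∧ K.ncard = d ∧
    ∀ K' : Set V, K' ⊆ Vset G 0 → IsClique G K' → K'.ncard ≤ d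

/-- Class `Q1`. -/
def Q1 (G : LoopyGraph V) : Prop :=
  ∃ K : Set V, K ⊆ Vset G 0 ∧ 4 ≤ K.ncard ∧ IsClique G K ∧
    (∀ u ∈ Vset G 0, (∀ w ∈ Vset G 0, ¬ G.Adj u w) ∨ u ∈ K) ∧
    IsClique G (Vset G 1 ∪ K) ∧
    Vset G 2 = ∅ ∧ Vinf G = ∅

/-- Class `Q2`. -/
def Q2 (G : LoopyGraph V) : Prop :=
  3 ≤ {u | u ∈ Vset G 0 ∧ (nbr G u ∩ Vset G 0).ncard = 2}.ncard ∧
  (∀ u ∈ Vset G 0,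
      (∀ w ∈ Vset G 0, ¬ G.Adj u w) ∨
        ((nbr G u ∩ Vset G 0).ncard = 2 ∧ ∀ w ∈ Vset G 1, G.Adj u w)) ∧
  IsClique G (Vset G 1) ∧
  (∀ u ∈ Vset G 2, nbr G u = Vset G 1) ∧
  Vset G 3 = ∅ ∧
  (Vinf G = ∅ ∨ (Vset G 1 = ∅ ∧ ∀ u ∈ Vinf G, deg G u = 2))

/-- The graph of loopy graphs `𝒢({k_i})` is connected: any two loopy graphs with degree
sequence `k` are linked by a finite sequence of valid double edge swaps. -/
def GConnected (k : V → ℕ) : Prop :=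
  ∀ G₁ G₂ : LoopyGraph V, (∀ v, deg G₁ v = k v) → (∀ v, deg G₂ v = k v) →
    Reach G₁ G₂

/-- `G₂` is obtained from `G₁` by a single valid triangle-loop swap: either a triangle on
three distinct vertices is replaced by three self-loops, or conversely. -/
def TriangleLoopSwap (G₁ G₂ : LoopyGraph V) : Prop :=
  ∃ u v w : V, u ≠ v ∧ v ≠ w ∧ u ≠ w ∧
    ((G₁.Adj u v ∧ G₁.Adj v w ∧ G₁.Adj w u ∧
        ¬ G₁.Adj u u ∧ ¬ G₁.Adj v v ∧ ¬ G₁.Adj w w ∧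
        ∀ a b : V, G₂.Adj a b ↔
          ((G₁.Adj a b ∧ s(a, b) ≠ s(u, v) ∧ s(a, b) ≠ s(v, w) ∧ s(a, b) ≠ s(w, u)) ∨
            s(a, b) = s(u, u) ∨ s(a, b) = s(v, v) ∨ s(a, b) = s(w, w))) ∨
      (G₁.Adj u u ∧ G₁.Adj v v ∧ G₁.Adj w w ∧
        ¬ G₁.Adj u v ∧ ¬ G₁.Adj v w ∧ ¬ G₁.Adj w u ∧
        ∀ a b : V, G₂.Adj a b ↔
          ((G₁.Adj a b ∧ s(a, b) ≠ s(u, u) ∧ s(a, b) ≠ s(v, v) ∧ s(a, b) ≠ s(w, w)) ∨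
            s(a, b) = s(u, v) ∨ s(a, b) = s(v, w) ∨ s(a, b) = s(w, u))))

/-- Reachability in the augmented graph of loopy graphs `𝒢_△`: a finite sequence of moves,
each a valid double edge swap or a valid triangle-loop swap. -/
def ReachTri (G₁ G₂ : LoopyGraph V) : Prop :=
  Relation.ReflTransGen
    (fun H₁ H₂ => DoubleEdgeSwap H₁ H₂ ∨ TriangleLoopSwap H₁ H₂) G₁ G₂

/-- `S` is a set of highest-degree vertices for the degree sequence `k`. -/
def TopSet (k : V → ℕ) (S : Set V) : Prop :=
  ∀ u ∈ S, ∀ v : V, v ∉ S → k v ≤ k u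

/-- A loopy graph is simple when it has no self-loops. -/
def IsSimple (G : LoopyGraph V) : Prop := ∀ v : V, ¬ G.Adj v v

/-- `k` is the degree sequence of some simple graph. -/
def SimpleGraphical (k : V → ℕ) : Prop :=
  ∃ G : LoopyGraph V, IsSimple G ∧ ∀ v, deg G v = k v

/-- `k` is `m`-simple-graphical: subtracting `2` from each of the `m` largest entries
yields a simple-graphical sequence. -/
def MSimpleGraphical (k : V → ℕ) (m : ℕ) : Prop :=
  ∃ S : Set V, S.ncard = m ∧ TopSet k S ∧ (∀ v ∈ S, 2 ≤ k v) ∧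
    SimpleGraphical (fun v : V => if v ∈ S then k v - 2 else k v)

/-- `m` is `m*`, the maximum `m` for which the sequence is `m`-simple-graphical. -/
def IsMStar (k : V → ℕ) (m : ℕ) : Prop :=
  MSimpleGraphical k m ∧ ∀ m' : ℕ, MSimpleGraphical k m' → m' ≤ m

/-- `G` is `m`-loopy: it has self-loops exactly at `m` highest-degree vertices. -/
def MLoopy (G : LoopyGraph V) (m : ℕ) : Prop :=
  (selfLoops G).ncard = m ∧ TopSet (deg G) (selfLoops G)

end LoopyGraph

namespace LoopyGraph

/-- The graph obtained from `G` by replacing the edges `(u,v)`, `(x,y)` by `(u,x)`, `(v,y)`. -/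
def swap {V : Type} (G : LoopyGraph V) (u v x y : V) : LoopyGraph V where
  Adj a b := (G.Adj a b ∧ s(a, b) ≠ s(u, v) ∧ s(a, b) ≠ s(x, y)) ∨
    s(a, b) = s(u, x) ∨ s(a, b) = s(v, y)
  symm a b h := by
    rw [Sym2.eq_swap (a := b) (b := a)]
    exact h.imp_left fun h' => ⟨G.symm a b h'.1, h'.2⟩

theorem reach_swap {V : Type} {G : LoopyGraph V} {u v x y : V}
    (huv : G.Adj u v) (hxy : G.Adj x y) (hne : s(u, v) ≠ s(x, y))
    (hux : ¬ G.Adj u x) (hvy : ¬ G.Adj v y) (hne' : s(u, x) ≠ s(v, y)) :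
    Reach G (G.swap u v x y) :=
  Relation.ReflTransGen.single
    ⟨u, v, x, y, huv, hxy, hne, hux, hvy, hne', fun _ _ => Iff.rfl⟩

/-- In a swap-maximal graph, the neighbors of a loop-free vertex are pairwise adjacent. -/
theorem SwapMaximal.adj_of_adj_of_adj {V : Type} [Finite V] {G : LoopyGraph V}
    (hG : G.SwapMaximal) {u p q : V} (hu : ¬ G.Adj u u) (hp : G.Adj u p) (hq : G.Adj u q)
    (hpq : p ≠ q) : G.Adj p q := by
  by_contra hn
  have hup : u ≠ p := by rintro rfl; exact hu hp
  have huq : u ≠ q := by rintro rfl; exact hu hq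
  have hr : Reach G (G.swap u p u q) := by
    refine reach_swap hp hq ?_ hu hn ?_ <;> simp <;> grind
  refine absurd (hG _ hr).1 (not_le.2 (Set.ncard_lt_ncard ?_ (Set.toFinite _)))
  refine (Set.ssubset_iff_of_subset fun w hw => Or.inl ⟨hw, ?_, ?_⟩).2
    ⟨u, Or.inr (Or.inl rfl), hu⟩ <;> simp <;> grind

theorem exists_adj_of_mem_Vset_one {V : Type} {G : LoopyGraph V} {v : V}
    (hv : v ∈ Vset G 1) : G.Adj v v ∧ ∃ a, ¬ G.Adj a a ∧ G.Adj a v := by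
  obtain ⟨h₁, h₀⟩ := hv
  obtain ⟨a, ha, hva⟩ := h₁.resolve_left h₀
  exact ⟨not_not.1 h₀, a, ha, G.symm _ _ hva⟩

end LoopyGraph

/-- In a swap-maximal loopy graph having a vertex `u ∈ V^0` of degree ≥ 2,
`V^1` is a clique. -/
theorem swap_maximal_V1_clique {V : Type} [Fintype V] (G : LoopyGraph V)
    (hmax : G.SwapMaximal) (hu : ∃ u ∈ LoopyGraph.Vset G 0, 2 ≤ G.deg u) :
    LoopyGraph.IsClique G (LoopyGraph.Vset G 1) := by
  intro x hx y hy hxy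
  obtain ⟨hxx, a, ha, hax⟩ := LoopyGraph.exists_adj_of_mem_Vset_one hx
  obtain ⟨hyy, b, hb, hby⟩ := LoopyGraph.exists_adj_of_mem_Vset_one hy
  by_contra hn
  have hax' : a ≠ x := by rintro rfl; exact ha hxx
  have hay' : a ≠ y := by rintro rfl; exact ha hyy
  have hbx' : b ≠ x := by rintro rfl; exact hb hxx
  have hby' : b ≠ y := by rintro rfl; exact hb hyy
  have hbx : ¬ G.Adj b x := fun h => hn (hmax.adj_of_adj_of_adj hb h hby hxy)
  have hne : a ≠ b := by rintro rfl; exact hbx hax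
  have hab : ¬ G.Adj a b := fun h =>
    hbx (hmax.adj_of_adj_of_adj ha h hax hbx')
  have hr : LoopyGraph.Reach G (G.swap a x b y) := by
    refine LoopyGraph.reach_swap hax hby ?_ hab hn ?_ <;> simp <;> grind
  have hloop (w : V) : (G.swap a x b y).Adj w w ↔ G.Adj w w := by
    simp only [LoopyGraph.swap, ne_eq, Sym2.eq_iff]
    grind
  have hloops : (G.swap a x b y).selfLoops = G.selfLoops := Set.ext hloop
  refine absurd ((hmax _ hr).2 (by rw [hloops]))
    (not_le.2 (Set.ncard_lt_ncard ?_ (Set.toFinite _)))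
  refine (Set.ssubset_iff_of_subset ?_).2 ⟨s(a, b), ?_, ?_⟩
  · rintro _ ⟨p, q, rfl, hpq, hp, hq⟩
    have hp' : ¬ G.Adj p p := hp
    have hq' : ¬ G.Adj q q := hq
    refine ⟨p, q, rfl, Or.inl ⟨hpq, ?_, ?_⟩, mt (hloop p).1 hp, mt (hloop q).1 hq⟩ <;>
      simp only [ne_eq, Sym2.eq_iff] <;> grind
  · exact ⟨a, b, rfl, Or.inr (Or.inl rfl), mt (hloop a).1 ha, mt (hloop b).1 hb⟩
  · rintro ⟨p, q, he, hpq, -, -⟩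
    rcases Sym2.eq_iff.1 he with ⟨rfl, rfl⟩ | ⟨rfl, rfl⟩
    exacts [hab hpq, hab (G.symm _ _ hpq)]
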